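/- Let μ be a Radon measure on ℝ^d with D = sup_{r>0, x∈ℝ^d} μ(B_r(x))/(ω_{d-1} r^{d-1}) < ∞, where ω_{d-1} is the volume of the unit (d-1)-ball. Then there is a constant c depending only on d such that ∫ |φ| dμ ≤ c D ∫ |∇φ| dx for all φ ∈ C_c¹(ℝ^d). -/

import Mathlib

open MeasureTheory Set Filter Topology
open scoped ENNReal NNReal

section
variable {E : Type*} [NormedAddCommGroup E] [NormedSpace ℝ E]

lemma enorm_sub_le_lintegral_enorm_fderiv {v : E → ℝ} (hv : ContDiff ℝ 1 v) (a b : E) :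
    ‖v b - v a‖ₑ ≤ ‖b - a‖ₑ * ∫⁻ s in Icc (0 : ℝ) 1, ‖fderiv ℝ v (a + s • (b - a))‖ₑ := by
  have hcont : Continuous fun s : ℝ => fderiv ℝ v (a + s • (b - a)) :=
    (hv.continuous_fderiv one_ne_zero).comp (by fun_prop)
  have hderiv (s : ℝ) : HasDerivAt (fun s : ℝ => v (a + s • (b - a)))
      (fderiv ℝ v (a + s • (b - a)) (b - a)) s := by
    have h₁ : HasDerivAt (fun s : ℝ => a + s • (b - a)) (b - a) s := by
      simpa using ((hasDerivAt_id s).smul_const (b - a)).const_add a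
    exact ((hv.differentiable one_ne_zero).differentiableAt.hasFDerivAt).comp_hasDerivAt s h₁
  have hftc := intervalIntegral.integral_eq_sub_of_hasDerivAt (a := 0) (b := 1)
    (fun s _ => hderiv s) ((hcont.clm_apply continuous_const).intervalIntegrable _ _)
  simp only [one_smul, add_sub_cancel, zero_smul, add_zero] at hftc
  rw [← hftc, intervalIntegral.integral_of_le zero_le_one, ← integral_Icc_eq_integral_Ioc]
  calc _ ≤ ∫⁻ s in Icc (0 : ℝ) 1, ‖fderiv ℝ v (a + s • (b - a)) (b - a)‖ₑ :=
        enorm_integral_le_lintegral_enorm _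
    _ ≤ ∫⁻ s in Icc (0 : ℝ) 1, ‖b - a‖ₑ * ‖fderiv ℝ v (a + s • (b - a))‖ₑ := by
        refine lintegral_mono fun s => ?_
        rw [mul_comm]
        exact ContinuousLinearMap.le_opENorm _ _
    _ = _ := lintegral_const_mul _ hcont.enorm.measurable

variable [MeasurableSpace E] [BorelSpace E] [FiniteDimensional ℝ E]
  (ν : Measure E) [ν.IsAddHaarMeasure]

lemma lintegral_comp_add_smul_sub_le {B : Set E} (hB : Convex ℝ B) (hBm : MeasurableSet B)
    {y : E} (hy : y ∈ B) {σ : ℝ} (h0 : 0 ≤ σ) (h1 : σ ≤ 1 / 2) {g : E → ℝ≥0∞}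
    (hg : Measurable g) :
    ∫⁻ x in B, g (x + σ • (y - x)) ∂ν ≤ 2 ^ Module.finrank ℝ E * ∫⁻ x in B, g x ∂ν := by
  have hσ : 1 - σ ≠ 0 := by linarith
  have hmaps {x : E} (hx : x ∈ B) : x + σ • (y - x) ∈ B :=
    hB.add_smul_sub_mem hx hy ⟨h0, by linarith⟩
  have heq (x : E) : x + σ • (y - x) = (1 - σ) • x + σ • y := by module
  calc ∫⁻ x in B, g (x + σ • (y - x)) ∂ν
      = ∫⁻ x, B.indicator (fun x => g (x + σ • (y - x))) x ∂ν := (lintegral_indicator hBm _).symm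
    _ ≤ ∫⁻ x, B.indicator g ((1 - σ) • x + σ • y) ∂ν := by
        refine lintegral_mono fun x => indicator_apply_le' (fun hx => ?_) fun _ => zero_le
        rw [← heq, indicator_of_mem (hmaps hx)]
    _ = ∫⁻ x, B.indicator g (x + σ • y) ∂(ν.map ((1 - σ) • ·)) :=
        (lintegral_map (f := fun x => B.indicator g (x + σ • y))
          ((hg.indicator hBm).comp (measurable_add_const _)) (measurable_const_smul _)).symm
    _ = ENNReal.ofReal |((1 - σ) ^ Module.finrank ℝ E)⁻¹| * ∫⁻ x in B, g x ∂ν := by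
        rw [Measure.map_addHaar_smul ν hσ, lintegral_smul_measure,
          lintegral_add_right_eq_self, lintegral_indicator hBm, smul_eq_mul]
    _ ≤ _ := by
        gcongr
        rw [← inv_pow, abs_of_nonneg (pow_nonneg (inv_nonneg.2 (by linarith)) _),
          ENNReal.ofReal_pow (by simp; linarith)]
        gcongr
        refine ENNReal.ofReal_le_of_le_toReal ?_
        simpa using inv_anti₀ (by norm_num) (show (2 : ℝ)⁻¹ ≤ 1 - σ by linarith)

lemma lintegral_lintegral_enorm_sub_midpoint_le {v : E → ℝ} (hv : ContDiff ℝ 1 v) (c : E)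
    {r : ℝ} :
    ∫⁻ y in Metric.closedBall c r, ∫⁻ x in Metric.closedBall c r,
        ‖v (x + (1 / 2 : ℝ) • (y - x)) - v x‖ₑ ∂ν ∂ν ≤
      ENNReal.ofReal r * 2 ^ Module.finrank ℝ E * ν (Metric.closedBall c r) *
        ∫⁻ x in Metric.closedBall c r, ‖fderiv ℝ v x‖ₑ ∂ν := by
  set B := Metric.closedBall c r
  have hBm : MeasurableSet B := Metric.isClosed_closedBall.measurableSet
  set g : E → ℝ≥0∞ := fun x => ‖fderiv ℝ v x‖ₑ
  have hg : Continuous g := (hv.continuous_fderiv one_ne_zero).enorm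
  have hin {y : E} (hy : y ∈ B) : ∫⁻ x in B, ‖v (x + (1 / 2 : ℝ) • (y - x)) - v x‖ₑ ∂ν ≤
      ENNReal.ofReal r * (2 ^ Module.finrank ℝ E * ∫⁻ x in B, g x ∂ν) := by
    calc ∫⁻ x in B, ‖v (x + (1 / 2 : ℝ) • (y - x)) - v x‖ₑ ∂ν
        ≤ ∫⁻ x in B, ENNReal.ofReal r *
            (∫⁻ s in Icc (0 : ℝ) 1, g (x + (s / 2) • (y - x))) ∂ν := by
          refine setLIntegral_mono' hBm fun x hx => ?_
          refine (enorm_sub_le_lintegral_enorm_fderiv hv _ _).trans ?_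
          have hxy : ‖y - x‖ ≤ 2 * r := by
            rw [← dist_eq_norm]
            have := dist_triangle_right y x c
            have := Metric.mem_closedBall.1 hx
            have := Metric.mem_closedBall.1 hy
            linarith
          simp only [add_sub_cancel_left, smul_smul]
          refine mul_le_mul' ?_ (le_of_eq ?_)
          · rw [← ofReal_norm, norm_smul]
            refine ENNReal.ofReal_le_ofReal ?_
            norm_num
            linarith
          · simp [g, div_eq_mul_inv]
      _ = ENNReal.ofReal r * ∫⁻ s in Icc (0 : ℝ) 1, ∫⁻ x in B, g (x + (s / 2) • (y - x)) ∂ν := by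
          have hm : Measurable (Function.uncurry fun (x : E) (s : ℝ) =>
            g (x + (s / 2) • (y - x))) := by
              apply Continuous.measurable
              exact hg.comp (by fun_prop)
          rw [lintegral_const_mul (f := fun x => ∫⁻ s in Icc (0 : ℝ) 1, g (x + (s / 2) • (y - x))) _
            hm.lintegral_prod_right',
            lintegral_lintegral_swap hm.aemeasurable]
      _ ≤ ENNReal.ofReal r * ∫⁻ s in Icc (0 : ℝ) 1,
            (2 ^ Module.finrank ℝ E * ∫⁻ x in B, g x ∂ν) := by
          gcongr ENNReal.ofReal r * ?_
          refine setLIntegral_mono' measurableSet_Icc fun s hs => ?_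
          exact lintegral_comp_add_smul_sub_le ν (convex_closedBall c r) hBm hy
            (by linarith [hs.1]) (by linarith [hs.2]) hg.measurable
      _ = _ := by simp
  calc _ ≤ ∫⁻ y in B, ENNReal.ofReal r * (2 ^ Module.finrank ℝ E * ∫⁻ x in B, g x ∂ν) ∂ν :=
        setLIntegral_mono' hBm fun y hy => hin hy
    _ = _ := by
        rw [setLIntegral_const]
        ring

/-- Poincaré inequality on balls, in double integral form. -/
lemma lintegral_lintegral_enorm_sub_le {v : E → ℝ} (hv : ContDiff ℝ 1 v) (c : E) (r : ℝ) :
    ∫⁻ y in Metric.closedBall c r, ∫⁻ x in Metric.closedBall c r, ‖v x - v y‖ₑ ∂ν ∂ν ≤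
      2 * (ENNReal.ofReal r * 2 ^ Module.finrank ℝ E * ν (Metric.closedBall c r) *
        ∫⁻ x in Metric.closedBall c r, ‖fderiv ℝ v x‖ₑ ∂ν) := by
  set B := Metric.closedBall c r
  set f : E → E → ℝ≥0∞ := fun y x => ‖v (x + (1 / 2 : ℝ) • (y - x)) - v x‖ₑ
  have hm : Measurable (Function.uncurry f) := by
    have := hv.continuous
    exact Continuous.measurable (by simp only [f, Function.uncurry_def]; fun_prop)
  have hle (x y : E) : ‖v x - v y‖ₑ ≤ f y x + f x y := by
    have h : y + (1 / 2 : ℝ) • (x - y) = x + (1 / 2 : ℝ) • (y - x) := by module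
    simp only [f, h]
    rw [add_comm, ← enorm_neg (_ - v x)]
    refine le_trans (le_of_eq ?_) (enorm_add_le _ _)
    congr 1
    ring
  calc _ ≤ ∫⁻ y in B, ∫⁻ x in B, (f y x + f x y) ∂ν ∂ν := by
        gcongr
        exact hle _ _
    _ = (∫⁻ y in B, ∫⁻ x in B, f y x ∂ν ∂ν) + ∫⁻ y in B, ∫⁻ x in B, f x y ∂ν ∂ν := by
        rw [← lintegral_add_left (f := fun y => ∫⁻ x in B, f y x ∂ν) hm.lintegral_prod_right']
        exact lintegral_congr fun y => lintegral_add_left hm.of_uncurry_left _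
    _ = 2 * ∫⁻ y in B, ∫⁻ x in B, f y x ∂ν ∂ν := by
        rw [lintegral_lintegral_swap (f := fun y x => f x y) (hm.comp measurable_swap).aemeasurable,
          two_mul]
    _ ≤ _ := by
        gcongr
        exact lintegral_lintegral_enorm_sub_midpoint_le ν hv c


/-- Around a point of an open set of finite measure there is a ball in which both the set and its
complement occupy a fixed proportion of the volume. -/
lemma exists_closedBall_balanced {U : Set E} (hU : IsOpen U) {R : ℝ}
    (hR : 2 * ν U < ν (Metric.closedBall 0 R)) {x : E} (hx : x ∈ U) :
    ∃ r, 0 < r ∧ r ≤ 2 * R ∧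
      ν (Metric.closedBall x r) ≤ 2 * ν (Metric.closedBall x r \ U) ∧
      ν (Metric.closedBall x r) ≤ 2 ^ (Module.finrank ℝ E + 1) * ν (Metric.closedBall x r ∩ U) := by
  obtain ⟨r₀, hr₀, hball⟩ := Metric.nhds_basis_closedBall.mem_iff.1 (hU.mem_nhds hx)
  have hsplit (r : ℝ) : ν (Metric.closedBall x r) =
      ν (Metric.closedBall x r ∩ U) + ν (Metric.closedBall x r \ U) :=
    (measure_inter_add_sdiff _ hU.measurableSet).symm
  have hlarge {r : ℝ} (h : R ≤ r) :
      2 * ν (Metric.closedBall x r ∩ U) < ν (Metric.closedBall x r) :=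
    calc 2 * ν (Metric.closedBall x r ∩ U) ≤ 2 * ν U := by gcongr; exact inter_subset_right
      _ < ν (Metric.closedBall 0 R) := hR
      _ = ν (Metric.closedBall x R) := (Measure.addHaar_closedBall_center ν x R).symm
      _ ≤ _ := measure_mono (Metric.closedBall_subset_closedBall h)
  have hex : ∃ k : ℕ, 2 * ν (Metric.closedBall x (2 ^ k * r₀) ∩ U) <
      ν (Metric.closedBall x (2 ^ k * r₀)) := by
    obtain ⟨k, hk⟩ := pow_unbounded_of_one_lt (R / r₀) one_lt_two
    exact ⟨k, hlarge ((div_lt_iff₀ hr₀).1 hk).le⟩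
  classical
  have hk := Nat.find_spec hex
  have hmin : ∀ m < Nat.find hex, _ := fun m hm => Nat.find_min hex hm
  generalize Nat.find hex = k at hk hmin
  obtain _ | k := k
  · have h : Metric.closedBall x (2 ^ 0 * r₀) ∩ U = Metric.closedBall x (2 ^ 0 * r₀) := by
      simpa using hball
    rw [h] at hk
    exact absurd hk (not_lt.2 (le_mul_of_one_le_left' one_le_two))
  · have hprev := hmin k (Nat.lt_succ_self k)
    have hr : 2 ^ (k + 1) * r₀ = 2 * (2 ^ k * r₀) := by ring
    rw [hr] at hk
    set ρ := 2 ^ k * r₀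
    have hρ0 : 0 < ρ := by positivity
    have hρR : ρ < R := lt_of_not_ge fun h => hprev (hlarge h)
    refine ⟨2 * ρ, by positivity, by linarith, ?_, ?_⟩
    · have := hsplit (2 * ρ)
      have hlt : ν (Metric.closedBall x (2 * ρ) ∩ U) < ν (Metric.closedBall x (2 * ρ) \ U) := by
        rw [this, two_mul] at hk
        exact lt_of_add_lt_add_left hk
      rw [this, two_mul (ν _)]
      exact add_le_add_left hlt.le _
    · calc ν (Metric.closedBall x (2 * ρ))
          = 2 ^ Module.finrank ℝ E * ν (Metric.closedBall x ρ) := by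
            rw [Measure.addHaar_closedBall_mul ν x zero_le_two hρ0.le,
              ENNReal.ofReal_pow zero_le_two, ENNReal.ofReal_ofNat,
              Measure.addHaar_closedBall_center ν x]
        _ ≤ 2 ^ Module.finrank ℝ E * (2 * ν (Metric.closedBall x ρ ∩ U)) := by
            gcongr
            exact not_lt.1 hprev
        _ ≤ 2 ^ Module.finrank ℝ E * (2 * ν (Metric.closedBall x (2 * ρ) ∩ U)) := by
            gcongr
            linarith
        _ = _ := by ring

lemma measure_inter_mul_measure_diff_le_liminf {U : Set E} (hU : MeasurableSet U) {v : ℕ → E → ℝ}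
    (hv : ∀ n, ContDiff ℝ 1 (v n)) (h0 : ∀ n, ∀ x ∉ U, v n x = 0)
    (h1 : ∀ x ∈ U, Tendsto (v · x) atTop (𝓝 1)) (c : E) (r : ℝ) :
    ν (Metric.closedBall c r ∩ U) * ν (Metric.closedBall c r \ U) ≤
      2 * (ENNReal.ofReal r * 2 ^ Module.finrank ℝ E * ν (Metric.closedBall c r)) *
        liminf (fun n => ∫⁻ x in Metric.closedBall c r, ‖fderiv ℝ (v n) x‖ₑ ∂ν) atTop := by
  set B := Metric.closedBall c r
  have hBm : MeasurableSet B := Metric.isClosed_closedBall.measurableSet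
  have hBfin : ν B ≠ ∞ := measure_closedBall_lt_top.ne
  have hfatou : ν (B ∩ U) ≤ liminf (fun n => ∫⁻ x in B ∩ U, ‖v n x‖ₑ ∂ν) atTop := by
    calc ν (B ∩ U) = ∫⁻ x in B ∩ U, 1 ∂ν := by simp
      _ = ∫⁻ x in B ∩ U, liminf (fun n => ‖v n x‖ₑ) atTop ∂ν := by
        refine setLIntegral_congr_fun (hBm.inter hU) fun x hx => ?_
        simpa using ((h1 x hx.2).enorm).liminf_eq.symm
      _ ≤ _ := lintegral_liminf_le fun n => (hv n).continuous.enorm.measurable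
  have hpoincare (n : ℕ) : (∫⁻ x in B ∩ U, ‖v n x‖ₑ ∂ν) * ν (B \ U) ≤
      2 * (ENNReal.ofReal r * 2 ^ Module.finrank ℝ E * ν B) *
        ∫⁻ x in B, ‖fderiv ℝ (v n) x‖ₑ ∂ν := by
    calc (∫⁻ x in B ∩ U, ‖v n x‖ₑ ∂ν) * ν (B \ U)
        = ∫⁻ y in B \ U, ∫⁻ x in B ∩ U, ‖v n x‖ₑ ∂ν ∂ν := (setLIntegral_const _ _).symm
      _ = ∫⁻ y in B \ U, ∫⁻ x in B ∩ U, ‖v n x - v n y‖ₑ ∂ν ∂ν :=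
        setLIntegral_congr_fun (hBm.diff hU) fun y hy => by simp [h0 n y hy.2]
      _ ≤ ∫⁻ y in B, ∫⁻ x in B, ‖v n x - v n y‖ₑ ∂ν ∂ν := by
        refine (lintegral_mono_set sdiff_subset).trans (lintegral_mono fun y => ?_)
        exact lintegral_mono_set inter_subset_left
      _ ≤ _ := by
        rw [mul_assoc]
        exact lintegral_lintegral_enorm_sub_le ν (hv n) c r
  have hC : 2 * (ENNReal.ofReal r * 2 ^ Module.finrank ℝ E * ν B) ≠ ∞ := by finiteness
  calc ν (B ∩ U) * ν (B \ U)
      ≤ ν (B \ U) * liminf (fun n => ∫⁻ x in B ∩ U, ‖v n x‖ₑ ∂ν) atTop := by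
        rw [mul_comm]
        gcongr
    _ = liminf (fun n => ν (B \ U) * ∫⁻ x in B ∩ U, ‖v n x‖ₑ ∂ν) atTop :=
        (ENNReal.liminf_const_mul_of_ne_top (measure_ne_top_of_subset sdiff_subset hBfin)).symm
    _ ≤ liminf (fun n => 2 * (ENNReal.ofReal r * 2 ^ Module.finrank ℝ E * ν B) *
          ∫⁻ x in B, ‖fderiv ℝ (v n) x‖ₑ ∂ν) atTop := by
        refine liminf_le_liminf (Eventually.of_forall fun n => ?_)
        rw [mul_comm]
        exact hpoincare n
    _ = _ := ENNReal.liminf_const_mul_of_ne_top hC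
lemma ofReal_pow_le_liminf_lintegral_enorm_fderiv [Nontrivial E] {U : Set E}
    (hU : MeasurableSet U) {v : ℕ → E → ℝ} (hv : ∀ n, ContDiff ℝ 1 (v n))
    (h0 : ∀ n, ∀ x ∉ U, v n x = 0) (h1 : ∀ x ∈ U, Tendsto (v · x) atTop (𝓝 1)) {c : E} {r : ℝ}
    (hr : 0 < r) (hcompl : ν (Metric.closedBall c r) ≤ 2 * ν (Metric.closedBall c r \ U))
    (hinter : ν (Metric.closedBall c r) ≤
      2 ^ (Module.finrank ℝ E + 1) * ν (Metric.closedBall c r ∩ U)) :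
    ENNReal.ofReal r ^ (Module.finrank ℝ E - 1) ≤
      2 ^ (2 * Module.finrank ℝ E + 3) / ν (Metric.closedBall 0 1) *
        liminf (fun n => ∫⁻ x in Metric.closedBall c r, ‖fderiv ℝ (v n) x‖ₑ ∂ν) atTop := by
  have hmul := measure_inter_mul_measure_diff_le_liminf ν hU hv h0 h1 c r
  set L := liminf (fun n => ∫⁻ x in Metric.closedBall c r, ‖fderiv ℝ (v n) x‖ₑ ∂ν) atTop
  have hBeq : ν (Metric.closedBall c r) = ENNReal.ofReal r *
      ENNReal.ofReal r ^ (Module.finrank ℝ E - 1) * ν (Metric.closedBall 0 1) := by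
    rw [Measure.addHaar_closedBall' ν c hr.le, ENNReal.ofReal_pow hr.le,
      mul_pow_sub_one Module.finrank_pos.ne']
  set B := Metric.closedBall c r
  set n := Module.finrank ℝ E
  have hB0 : ν B ≠ 0 := (Metric.measure_closedBall_pos ν c hr).ne'
  have hBt : ν B ≠ ∞ := measure_closedBall_lt_top.ne
  have hω0 : ν (Metric.closedBall (0 : E) 1) ≠ 0 := (Metric.measure_closedBall_pos ν 0 one_pos).ne'
  have hωt : ν (Metric.closedBall (0 : E) 1) ≠ ∞ := measure_closedBall_lt_top.ne
  have hr0 : ENNReal.ofReal r ≠ 0 := by simpa using hr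
  have hsq : ν B * ν B ≤ ν B * (ENNReal.ofReal r * (2 ^ (2 * n + 3) * L)) :=
    calc ν B * ν B ≤ (2 * ν (B \ U)) * (2 ^ (n + 1) * ν (B ∩ U)) := mul_le_mul' hcompl hinter
      _ = 2 ^ (n + 2) * (ν (B ∩ U) * ν (B \ U)) := by ring
      _ ≤ 2 ^ (n + 2) * (2 * (ENNReal.ofReal r * 2 ^ n * ν B) * L) := by gcongr
      _ = _ := by ring
  rw [ENNReal.mul_le_mul_iff_right hB0 hBt, hBeq, mul_assoc,
    ENNReal.mul_le_mul_iff_right hr0 ENNReal.ofReal_ne_top] at hsq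
  rw [← ENNReal.mul_div_right_comm]
  exact (ENNReal.le_div_iff_mul_le (.inl hω0) (.inl hωt)).2 hsq

/-- A form of the boxing inequality: the perimeter of `U` is replaced by the lower limit of the
total variations of smooth approximations of its indicator function. -/
lemma measure_le_liminf_lintegral_enorm_fderiv [Nontrivial E] {μ : Measure E} {A : ℝ≥0∞}
    (hμ : ∀ x r, 0 < r → μ (Metric.ball x r) ≤ A * ENNReal.ofReal r ^ (Module.finrank ℝ E - 1))
    {U : Set E} (hU : IsOpen U) (hUfin : ν U ≠ ∞) {v : ℕ → E → ℝ} (hv : ∀ n, ContDiff ℝ 1 (v n))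
    (h0 : ∀ n, ∀ x ∉ U, v n x = 0) (h1 : ∀ x ∈ U, Tendsto (v · x) atTop (𝓝 1)) :
    μ U ≤ A * 6 ^ (Module.finrank ℝ E - 1) *
      (2 ^ (2 * Module.finrank ℝ E + 3) / ν (Metric.closedBall 0 1)) *
        liminf (fun n => ∫⁻ x, ‖fderiv ℝ (v n) x‖ₑ ∂ν) atTop := by
  obtain ⟨R, hR⟩ : ∃ R : ℝ, 2 * ν U < ν (Metric.closedBall 0 R) := by
    have htop : Tendsto (fun k : ℕ => ν (Metric.closedBall (0 : E) k)) atTop (𝓝 ∞) := by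
      have := NormedSpace.noncompactSpace ℝ E
      rw [← measure_univ_of_isAddLeftInvariant ν, ← Metric.iUnion_closedBall_nat (0 : E)]
      exact tendsto_measure_iUnion_atTop fun i j hij =>
        Metric.closedBall_subset_closedBall (by exact_mod_cast hij)
    have hlt : 2 * ν U < ∞ := ENNReal.mul_lt_top (by simp) hUfin.lt_top
    obtain ⟨k, hk⟩ := (htop.eventually (lt_mem_nhds hlt)).exists
    exact ⟨k, hk⟩
  choose! r hr0 hrR hcompl hinter using fun x (hx : x ∈ U) => exists_closedBall_balanced ν hU hR hx
  obtain ⟨T, hTU, hdisj, hcover⟩ := Vitali.exists_disjoint_subfamily_covering_enlargement_closedBall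
    U id r (2 * R) hrR 5 (by norm_num)
  simp only [id_eq] at hdisj hcover
  have hT : T.Countable := hdisj.countable_of_nonempty_interior fun x hx => by
    rw [interior_closedBall x (hr0 x (hTU hx)).ne']
    exact Metric.nonempty_ball.2 (hr0 x (hTU hx))
  have hTc : Countable T := hT
  set n := Module.finrank ℝ E
  set C := 2 ^ (2 * n + 3) / ν (Metric.closedBall (0 : E) 1)
  have hball {x : E} (hx : x ∈ U) : μ (Metric.closedBall x (5 * r x)) ≤ A * 6 ^ (n - 1) * C *
      liminf (fun n => ∫⁻ y in Metric.closedBall x (r x), ‖fderiv ℝ (v n) y‖ₑ ∂ν) atTop := by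
    have := hr0 x hx
    calc μ (Metric.closedBall x (5 * r x)) ≤ μ (Metric.ball x (6 * r x)) :=
          measure_mono (Metric.closedBall_subset_ball (by linarith))
      _ ≤ A * ENNReal.ofReal (6 * r x) ^ (n - 1) := hμ _ _ (by positivity)
      _ = A * 6 ^ (n - 1) * ENNReal.ofReal (r x) ^ (n - 1) := by
          rw [ENNReal.ofReal_mul (by norm_num), ENNReal.ofReal_ofNat, mul_pow, mul_assoc]
      _ ≤ _ := by
          rw [mul_assoc _ C]
          gcongr
          exact ofReal_pow_le_liminf_lintegral_enorm_fderiv ν hU.measurableSet hv h0 h1 this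
            (hcompl x hx) (hinter x hx)
  calc μ U ≤ μ (⋃ x : T, Metric.closedBall (x : E) (5 * r x)) := by
        refine measure_mono fun x hx => ?_
        obtain ⟨b, hb, hsub⟩ := hcover x hx
        exact mem_iUnion.2 ⟨⟨b, hb⟩, hsub (Metric.mem_closedBall_self (hr0 x hx).le)⟩
    _ ≤ ∑' x : T, μ (Metric.closedBall (x : E) (5 * r x)) := measure_iUnion_le _
    _ ≤ ∑' x : T, A * 6 ^ (n - 1) * C * liminf (fun n =>
          ∫⁻ y in Metric.closedBall (x : E) (r x), ‖fderiv ℝ (v n) y‖ₑ ∂ν) atTop :=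
        ENNReal.tsum_le_tsum fun x => hball (hTU x.2)
    _ = A * 6 ^ (n - 1) * C * ∫⁻ x : T, liminf (fun n =>
          ∫⁻ y in Metric.closedBall (x : E) (r x), ‖fderiv ℝ (v n) y‖ₑ ∂ν) atTop ∂.count := by
        rw [ENNReal.tsum_mul_left, lintegral_count]
    _ ≤ A * 6 ^ (n - 1) * C * liminf (fun n => ∫⁻ x : T,
          ∫⁻ y in Metric.closedBall (x : E) (r x), ‖fderiv ℝ (v n) y‖ₑ ∂ν ∂.count) atTop := by
        gcongr
        exact lintegral_liminf_le fun n => measurable_of_countable _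
    _ ≤ _ := by
        refine mul_le_mul' le_rfl (liminf_le_liminf (Eventually.of_forall fun n => ?_))
        rw [lintegral_count,
          ← lintegral_biUnion hT (fun _ _ => Metric.isClosed_closedBall.measurableSet) hdisj]
        exact setLIntegral_le_lintegral _ _

lemma exists_enorm_deriv_smoothTransition_le :
    ∃ M : ℝ≥0, ∀ x : ℝ,
      ‖deriv Real.smoothTransition x‖ₑ ≤ (Icc 0 1).indicator (fun _ => (M : ℝ≥0∞)) x := by
  have hcont : Continuous (deriv Real.smoothTransition) :=
    (Real.smoothTransition.contDiff (n := 1)).continuous_deriv_one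
  obtain ⟨M, hM⟩ := isCompact_Icc.exists_bound_of_continuousOn
    (s := Icc (0 : ℝ) 1) hcont.continuousOn
  refine ⟨M.toNNReal, fun x => ?_⟩
  by_cases hx : x ∈ Icc (0 : ℝ) 1
  · rw [indicator_of_mem hx, ← ofReal_norm]
    exact ENNReal.ofReal_le_ofReal (hM x hx)
  · have hconst : ∃ c, Real.smoothTransition =ᶠ[𝓝 x] fun _ => c := by
      obtain h | h : x < 0 ∨ 1 < x := by
        by_contra! h
        exact hx h
      · refine ⟨0, ?_⟩
        filter_upwards [Iio_mem_nhds h] with y hy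
        exact Real.smoothTransition.zero_of_nonpos (le_of_lt hy)
      · refine ⟨1, ?_⟩
        filter_upwards [Ioi_mem_nhds h] with y hy
        exact Real.smoothTransition.one_of_one_le (le_of_lt hy)
    obtain ⟨c, hc⟩ := hconst
    simp [hc.deriv_eq]

lemma lintegral_enorm_mul_deriv_smoothTransition_le {M : ℝ≥0}
    (hM : ∀ x : ℝ, ‖deriv Real.smoothTransition x‖ₑ ≤ (Icc 0 1).indicator (fun _ => (M : ℝ≥0∞)) x)
    (n : ℕ) (a : ℝ) : ∫⁻ t : ℝ, ‖n * deriv Real.smoothTransition (n * (a - t))‖ₑ ≤ M := by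
  obtain rfl | hn := Nat.eq_zero_or_pos n
  · simp
  have hn' : (0 : ℝ) < n := by exact_mod_cast hn
  calc ∫⁻ t : ℝ, ‖n * deriv Real.smoothTransition (n * (a - t))‖ₑ
      ≤ ∫⁻ t : ℝ, (Icc (a - 1 / n) a).indicator (fun _ => (n : ℝ≥0∞) * M) t := by
        refine lintegral_mono fun t => ?_
        rw [enorm_mul, indicator_const_mul]
        refine mul_le_mul' (by simp) ((hM _).trans (le_of_eq ?_))
        refine indicator_eq_indicator ?_ rfl
        rw [mem_Icc, mem_Icc, sub_le_comm, le_div_iff₀' hn', mul_nonneg_iff_of_pos_left hn',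
          sub_nonneg]
        exact and_comm
    _ = M := by
        rw [lintegral_indicator_const measurableSet_Icc, Real.volume_Icc, sub_sub_cancel,
          ENNReal.ofReal_div_of_pos hn', ENNReal.ofReal_one, ENNReal.ofReal_natCast, mul_right_comm,
          one_div, ENNReal.mul_inv_cancel (by exact_mod_cast hn.ne') (by simp), one_mul]

/-- One-sided Meyers–Ziemer inequality, for the positive part of `φ`. -/
lemma lintegral_ofReal_le_lintegral_enorm_fderiv [Nontrivial E] {M : ℝ≥0}
    (hM : ∀ x : ℝ, ‖deriv Real.smoothTransition x‖ₑ ≤ (Icc 0 1).indicator (fun _ => (M : ℝ≥0∞)) x)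
    {μ : Measure E} {A : ℝ≥0∞}
    (hμ : ∀ x r, 0 < r → μ (Metric.ball x r) ≤ A * ENNReal.ofReal r ^ (Module.finrank ℝ E - 1))
    {φ : E → ℝ} (hφ : ContDiff ℝ 1 φ) (hsupp : HasCompactSupport φ) :
    ∫⁻ x, ENNReal.ofReal (φ x) ∂μ ≤ A * (6 ^ (Module.finrank ℝ E - 1) *
      (2 ^ (2 * Module.finrank ℝ E + 3) / ν (Metric.closedBall 0 1)) * M) *
        ∫⁻ x, ‖fderiv ℝ φ x‖ₑ ∂ν := by
  set K := A * 6 ^ (Module.finrank ℝ E - 1) *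
    (2 ^ (2 * Module.finrank ℝ E + 3) / ν (Metric.closedBall (0 : E) 1))
  set F : ℕ → ℝ → E → ℝ≥0∞ := fun n t x =>
    ‖n * deriv Real.smoothTransition (n * (φ x - t))‖ₑ * ‖fderiv ℝ φ x‖ₑ
  have hS : ContDiff ℝ 1 Real.smoothTransition := Real.smoothTransition.contDiff
  have hφ' : Continuous (fderiv ℝ φ) := hφ.continuous_fderiv one_ne_zero
  have hF (n : ℕ) : Measurable (Function.uncurry (F n)) := by
    have := hS.continuous_deriv_one
    have := hφ.continuous
    have h₁ : Measurable fun p : ℝ × E =>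
        ‖n * deriv Real.smoothTransition (n * (φ p.2 - p.1))‖ₑ :=
      Continuous.measurable (by fun_prop)
    have h₂ : Measurable fun p : ℝ × E => ‖fderiv ℝ φ p.2‖ₑ :=
      Continuous.measurable (by fun_prop)
    exact h₁.mul h₂
  have hfderiv (n : ℕ) (t : ℝ) (x : E) :
      ‖fderiv ℝ (fun x => Real.smoothTransition (n * (φ x - t))) x‖ₑ = F n t x := by
    have h₁ : HasFDerivAt (fun x => (n : ℝ) * (φ x - t)) ((n : ℝ) • fderiv ℝ φ x) x :=
      ((hφ.differentiable one_ne_zero x).hasFDerivAt.sub_const t).const_mul _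
    have h₂ := ((hS.differentiable one_ne_zero _).hasDerivAt.comp_hasFDerivAt x h₁).fderiv
    simp only [Function.comp_def] at h₂
    rw [h₂, smul_smul, enorm_smul, mul_comm (deriv _ _)]
  have hlevel {t : ℝ} (ht : 0 < t) :
      μ {x | t < φ x} ≤ K * liminf (fun n => ∫⁻ x, F n t x ∂ν) atTop := by
    have hfin : ν {x | t < φ x} ≠ ∞ := by
      refine measure_ne_top_of_subset (fun x hx => subset_tsupport φ ?_) hsupp.measure_lt_top.ne
      exact (ht.trans hx).ne'
    simp only [← hfderiv]
    refine measure_le_liminf_lintegral_enorm_fderiv ν hμ (isOpen_lt continuous_const hφ.continuous)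
      hfin (fun n => hS.comp (contDiff_const.mul (hφ.sub contDiff_const))) (fun n x hx => ?_)
      fun x hx => ?_
    · refine Real.smoothTransition.zero_of_nonpos (mul_nonpos_of_nonneg_of_nonpos n.cast_nonneg ?_)
      simpa using hx
    · refine tendsto_const_nhds.congr' ?_
      have h : Tendsto (fun n : ℕ => (n : ℝ) * (φ x - t)) atTop atTop :=
        tendsto_natCast_atTop_atTop.atTop_mul_const (sub_pos.2 hx)
      filter_upwards [h.eventually_ge_atTop 1] with n hn
      exact (Real.smoothTransition.one_of_one_le hn).symm
  have hFint (n : ℕ) : ∫⁻ t : ℝ, ∫⁻ x, F n t x ∂ν ≤ M * ∫⁻ x, ‖fderiv ℝ φ x‖ₑ ∂ν := by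
    rw [lintegral_lintegral_swap (hF n).aemeasurable, ← lintegral_const_mul _ hφ'.enorm.measurable]
    refine lintegral_mono fun x => ?_
    have hm : Measurable fun t : ℝ => ‖n * deriv Real.smoothTransition (n * (φ x - t))‖ₑ := by
      have := hS.continuous_deriv_one
      exact Continuous.measurable (by fun_prop)
    rw [lintegral_mul_const _ hm]
    gcongr
    exact lintegral_enorm_mul_deriv_smoothTransition_le hM n (φ x)
  calc ∫⁻ x, ENNReal.ofReal (φ x) ∂μ = ∫⁻ x, ENNReal.ofReal (max (φ x) 0) ∂μ := by simp
    _ = ∫⁻ t in Ioi 0, μ {x | t < max (φ x) 0} :=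
        lintegral_eq_lintegral_meas_lt μ (Eventually.of_forall fun x => le_max_right _ _)
          (hφ.continuous.max continuous_const).aemeasurable
    _ ≤ ∫⁻ t in Ioi 0, K * liminf (fun n => ∫⁻ x, F n t x ∂ν) atTop := by
        refine setLIntegral_mono' measurableSet_Ioi fun t ht => ?_
        have h : {x | t < max (φ x) 0} = {x | t < φ x} := by
          ext x
          simp [not_lt.2 (le_of_lt (mem_Ioi.1 ht))]
        rw [h]
        exact hlevel ht
    _ ≤ ∫⁻ t, K * liminf (fun n => ∫⁻ x, F n t x ∂ν) atTop := setLIntegral_le_lintegral _ _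
    _ = K * ∫⁻ t, liminf (fun n => ∫⁻ x, F n t x ∂ν) atTop :=
        lintegral_const_mul _ (Measurable.liminf fun n => (hF n).lintegral_prod_right')
    _ ≤ K * liminf (fun n => ∫⁻ t, ∫⁻ x, F n t x ∂ν) atTop := by
        gcongr
        exact lintegral_liminf_le fun n => (hF n).lintegral_prod_right'
    _ ≤ K * (M * ∫⁻ x, ‖fderiv ℝ φ x‖ₑ ∂ν) := by
        gcongr
        exact (liminf_le_liminf (Eventually.of_forall hFint)).trans_eq (liminf_const _)
    _ = _ := by ring

end

/-- Meyers–Ziemer inequality: there is a constant `c = c(d)` such that for every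
Radon measure `μ` on `ℝ^d` whose `(d-1)`-density ratios
`μ(B_r(x))/(ω_{d-1} r^{d-1})` are bounded by `D` at all scales and centers,
`∫|φ| dμ ≤ c D ∫|∇φ| dx` for all `φ ∈ C_c¹(ℝ^d)`. -/
theorem stmt_16 (d : ℕ) (hd : 2 ≤ d) :
    ∃ c > (0 : ℝ),
      ∀ (μ : Measure (EuclideanSpace ℝ (Fin d))) (_ : IsFiniteMeasureOnCompacts μ)
        (D : ℝ),
        (∀ (x : EuclideanSpace ℝ (Fin d)) (r : ℝ), 0 < r →
          (μ (Metric.ball x r)).toReal ≤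
            D * (volume (Metric.ball (0 : EuclideanSpace ℝ (Fin (d - 1))) 1)).toReal
              * r ^ (d - 1)) →
        ∀ φ : EuclideanSpace ℝ (Fin d) → ℝ, ContDiff ℝ 1 φ → HasCompactSupport φ →
          (∫ x, |φ x| ∂μ) ≤ c * D * ∫ x, ‖fderiv ℝ φ x‖ := by
  obtain ⟨M, hM⟩ := exists_enorm_deriv_smoothTransition_le
  have : Nontrivial (EuclideanSpace ℝ (Fin d)) := by
    have : Nonempty (Fin d) := ⟨⟨0, by omega⟩⟩
    infer_instance
  set ω := (volume (Metric.ball (0 : EuclideanSpace ℝ (Fin (d - 1))) 1)).toReal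
  have hω0 : 0 < ω := ENNReal.toReal_pos (Metric.measure_ball_pos volume _ one_pos).ne'
    measure_ball_lt_top.ne
  set C : ℝ≥0∞ := 6 ^ (d - 1) * (2 ^ (2 * d + 3) /
    volume (Metric.closedBall (0 : EuclideanSpace ℝ (Fin d)) 1)) * M with hC
  have hCt : C ≠ ∞ := by
    have : volume (Metric.closedBall (0 : EuclideanSpace ℝ (Fin d)) 1) ≠ 0 :=
      (Metric.measure_closedBall_pos volume _ one_pos).ne'
    finiteness
  refine ⟨2 * ω * C.toReal + 1, by positivity, fun μ _ D hμ φ hφ hsupp => ?_⟩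
  have hD : 0 ≤ D := by
    have h := ENNReal.toReal_nonneg.trans (hμ 0 1 one_pos)
    rw [one_pow, mul_one] at h
    exact nonneg_of_mul_nonneg_left h hω0
  have hμ' (x : EuclideanSpace ℝ (Fin d)) (r : ℝ) (hr : 0 < r) : μ (Metric.ball x r) ≤
      ENNReal.ofReal (D * ω) *
        ENNReal.ofReal r ^ (Module.finrank ℝ (EuclideanSpace ℝ (Fin d)) - 1) := by
    rw [finrank_euclideanSpace_fin, ← ENNReal.ofReal_pow hr.le,
      ← ENNReal.ofReal_mul (by positivity)]
    exact (ENNReal.le_ofReal_iff_toReal_le measure_ball_lt_top.ne (by positivity)).2 (hμ x r hr)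
  have hpos := lintegral_ofReal_le_lintegral_enorm_fderiv volume hM hμ' hφ hsupp
  have hneg := lintegral_ofReal_le_lintegral_enorm_fderiv volume hM hμ' hφ.neg
    (hsupp.comp_left neg_zero)
  simp only [fderiv_fun_neg, enorm_neg] at hneg
  rw [finrank_euclideanSpace_fin, ← hC] at hpos hneg
  have hI : Integrable (fderiv ℝ φ) :=
    (hφ.continuous_fderiv one_ne_zero).integrable_of_hasCompactSupport (hsupp.fderiv ℝ)
  have habs : ∫⁻ x, ENNReal.ofReal |φ x| ∂μ ≤
      2 * (ENNReal.ofReal (D * ω) * C * ∫⁻ x, ‖fderiv ℝ φ x‖ₑ) := by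
    calc ∫⁻ x, ENNReal.ofReal |φ x| ∂μ
        ≤ ∫⁻ x, (ENNReal.ofReal (φ x) + ENNReal.ofReal (-φ x)) ∂μ := by
          refine lintegral_mono fun x => ?_
          obtain h | h := abs_choice (φ x) <;> rw [h] <;> simp
      _ = (∫⁻ x, ENNReal.ofReal (φ x) ∂μ) + ∫⁻ x, ENNReal.ofReal (-φ x) ∂μ :=
          lintegral_add_left hφ.continuous.measurable.ennreal_ofReal _
      _ ≤ _ := by
          rw [two_mul]
          exact add_le_add hpos hneg
  have hbound : (∫ x, |φ x| ∂μ) ≤ 2 * (D * ω * C.toReal * ∫ x, ‖fderiv ℝ φ x‖) := by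
    rw [integral_eq_lintegral_of_nonneg_ae (Eventually.of_forall fun x => abs_nonneg _)
      hφ.continuous.abs.aestronglyMeasurable, integral_norm_eq_lintegral_enorm hI.1]
    refine (ENNReal.toReal_mono ?_ habs).trans_eq ?_
    · have := hI.2.ne
      finiteness
    · simp [ENNReal.toReal_mul, ENNReal.toReal_ofReal (mul_nonneg hD hω0.le)]
  have hG : 0 ≤ ∫ x, ‖fderiv ℝ φ x‖ := integral_nonneg fun x => norm_nonneg _
  nlinarith [mul_nonneg hD hG]
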